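/- For every real C ≥ 1 and every natural number k ≥ 3 there exists a constant D > 0 with the following property. Let (X, d) be a metric space with basepoint x₀ ∈ X, and let φ : ℝ^k → X be a map satisfying d(φ(a), φ(b)) ≤ ‖a − b‖ ≤ C·d(φ(a), φ(b)) + C for all a, b ∈ ℝ^k. Suppose there exists b₀ ∈ ℝ^k with d(x₀, φ(b₀)) ≤ d(x₀, φ(a)) for all a ∈ ℝ^k. Then for every real r ≥ D, every L > 0, and every L-Lipschitz map γ : S¹ → ℝ^k (where S¹ is the unit circle in ℂ) satisfying d(x₀, φ(γ(z))) ≥ r for all z ∈ S¹, there exists a (D·L)-Lipschitz map f : D² → ℝ^k (where D² is the closed unit disk in ℂ) agreeing with γ on S¹ = ∂D² and satisfying d(x₀, φ(f(x))) ≥ r/D for all x ∈ D². -/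

import Mathlib

/-- The radial extension `x ↦ b ‖x‖ • h (x / ‖x‖)` of a bounded Lipschitz map `h` on the unit circle
is Lipschitz as soon as `b` is Lipschitz and vanishes at `0`. -/
theorem norm_radial_sub_le {E : Type*} [NormedAddCommGroup E] [NormedSpace ℝ E]
    {b : ℝ → ℝ} {β M K : ℝ} (hβ : 0 ≤ β) (hK : 0 ≤ K)
    (hb : ∀ s t, |b s - b t| ≤ β * |s - t|) (hb0 : b 0 = 0) {h : ℂ → E}
    (hM : ∀ u, ‖u‖ = 1 → ‖h u‖ ≤ M)
    (hh : ∀ u v, ‖u‖ = 1 → ‖v‖ = 1 → ‖h u - h v‖ ≤ K * ‖u - v‖) (x y : ℂ) :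
    ‖b ‖x‖ • h (x / ‖x‖) - b ‖y‖ • h (y / ‖y‖)‖ ≤ β * (M + 2 * K) * ‖x - y‖ := by
  have hM0 : 0 ≤ M := (norm_nonneg _).trans (hM 1 norm_one)
  have unit : ∀ z : ℂ, z ≠ 0 → ‖z / ‖z‖‖ = 1 := fun z hz => by
    simp [hz]
  have hxy : |‖x‖ - ‖y‖| ≤ ‖x - y‖ := abs_norm_sub_norm_le x y
  have hbound : |b ‖x‖ - b ‖y‖| ≤ β * ‖x - y‖ :=
    (hb _ _).trans (mul_le_mul_of_nonneg_left hxy hβ)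
  have hrest : β * M * ‖x - y‖ ≤ β * (M + 2 * K) * ‖x - y‖ := by
    gcongr
    linarith
  rcases eq_or_ne x 0 with rfl | hx
  · rcases eq_or_ne y 0 with rfl | hy
    · simp
    · rw [norm_zero, hb0, zero_smul, zero_sub, norm_neg, norm_smul, Real.norm_eq_abs]
      rw [norm_zero, hb0, zero_sub, abs_neg] at hbound
      calc |b ‖y‖| * ‖h (y / ‖y‖)‖ ≤ (β * ‖0 - y‖) * M :=
            mul_le_mul hbound (hM _ (unit y hy)) (norm_nonneg _) (by positivity)
        _ ≤ _ := by linarith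
  · rcases eq_or_ne y 0 with rfl | hy
    · rw [norm_zero, hb0, zero_smul, sub_zero, norm_smul, Real.norm_eq_abs]
      rw [norm_zero, hb0, sub_zero] at hbound
      calc |b ‖x‖| * ‖h (x / ‖x‖)‖ ≤ (β * ‖x - 0‖) * M :=
            mul_le_mul hbound (hM _ (unit x hx)) (norm_nonneg _) (by positivity)
        _ ≤ _ := by linarith
    · have hby : |b ‖y‖| ≤ β * ‖y‖ := by
        have := hb ‖y‖ 0
        rwa [hb0, sub_zero, sub_zero, abs_norm] at this
      have hdir : ‖y‖ * ‖x / ‖x‖ - y / ‖y‖‖ ≤ 2 * ‖x - y‖ := by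
        have hx' : (‖x‖ : ℂ) ≠ 0 := by simpa using hx
        have hy' : (‖y‖ : ℂ) ≠ 0 := by simpa using hy
        have e : (‖y‖ : ℂ) * (x / ‖x‖ - y / ‖y‖)
            = (x - y) + ((‖y‖ - ‖x‖ : ℝ) : ℂ) * (x / ‖x‖) := by
          push_cast
          field_simp
          ring
        calc ‖y‖ * ‖x / ‖x‖ - y / ‖y‖‖ = ‖(‖y‖ : ℂ) * (x / ‖x‖ - y / ‖y‖)‖ := by
              rw [norm_mul, Complex.norm_real, norm_norm]
          _ ≤ ‖x - y‖ + ‖((‖y‖ - ‖x‖ : ℝ) : ℂ) * (x / ‖x‖)‖ := by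
              rw [e]; exact norm_add_le _ _
          _ = ‖x - y‖ + |‖x‖ - ‖y‖| := by
              rw [norm_mul, unit x hx, mul_one, Complex.norm_real, Real.norm_eq_abs, abs_sub_comm]
          _ ≤ 2 * ‖x - y‖ := by linarith
      have e : b ‖x‖ • h (x / ‖x‖) - b ‖y‖ • h (y / ‖y‖)
          = (b ‖x‖ - b ‖y‖) • h (x / ‖x‖) + b ‖y‖ • (h (x / ‖x‖) - h (y / ‖y‖)) := by
        module
      calc _ ≤ |b ‖x‖ - b ‖y‖| * ‖h (x / ‖x‖)‖ + |b ‖y‖| * ‖h (x / ‖x‖) - h (y / ‖y‖)‖ := by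
            rw [e]
            refine (norm_add_le _ _).trans ?_
            rw [norm_smul, norm_smul, Real.norm_eq_abs, Real.norm_eq_abs]
        _ ≤ (β * ‖x - y‖) * M + (β * ‖y‖) * (K * ‖x / ‖x‖ - y / ‖y‖‖) := by
            gcongr
            · exact hM _ (unit x hx)
            · exact hh _ _ (unit x hx) (unit y hy)
        _ = β * M * ‖x - y‖ + β * K * (‖y‖ * ‖x / ‖x‖ - y / ‖y‖‖) := by ring
        _ ≤ β * M * ‖x - y‖ + β * K * (2 * ‖x - y‖) := by gcongr
        _ = _ := by ring

/-- The piecewise affine interpolation of a sequence indexed by `ℤ`. -/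
noncomputable def intInterpolation {E : Type*} [AddCommGroup E] [Module ℝ E]
    (v : ℤ → E) (t : ℝ) : E :=
  (1 - Int.fract t) • v ⌊t⌋ + Int.fract t • v (⌊t⌋ + 1)

theorem intInterpolation_add_int {E : Type*} [AddCommGroup E] [Module ℝ E] {v : ℤ → E} {N : ℤ}
    (hv : ∀ n, v (n + N) = v n) (t : ℝ) :
    intInterpolation v (t + N) = intInterpolation v t := by
  have h1 : v (⌊t⌋ + N + 1) = v (⌊t⌋ + 1) := by
    rw [add_right_comm, hv]
  simp [intInterpolation, hv, h1]

theorem norm_intInterpolation_sub_le {E : Type*} [NormedAddCommGroup E] [NormedSpace ℝ E]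
    {v : ℤ → E} {K : ℝ} (hv : ∀ n, ‖v (n + 1) - v n‖ ≤ K) (s t : ℝ) :
    ‖intInterpolation v s - intInterpolation v t‖ ≤ K * |s - t| := by
  wlog hst : s ≤ t generalizing s t
  · rw [norm_sub_rev, abs_sub_comm]
    exact this t s (le_of_not_ge hst)
  have hK : 0 ≤ K := (norm_nonneg _).trans (hv 0)
  rw [abs_sub_comm, abs_of_nonneg (sub_nonneg.2 hst)]
  have hs := Int.floor_add_fract s
  have ht := Int.floor_add_fract t
  have hs0 := Int.fract_nonneg s
  have ht0 := Int.fract_nonneg t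
  have hs1 := (Int.fract_lt_one s).le
  rcases (Int.floor_mono hst).eq_or_lt with h | h
  · have e : intInterpolation v s - intInterpolation v t
        = (t - s) • -(v (⌊t⌋ + 1) - v ⌊t⌋) := by
      have : t - s = Int.fract t - Int.fract s := by
        have : (⌊s⌋ : ℝ) = ⌊t⌋ := by rw [h]
        linarith
      rw [this, intInterpolation, intInterpolation, h]
      module
    rw [e, norm_smul, norm_neg, Real.norm_eq_abs, abs_of_nonneg (sub_nonneg.2 hst), mul_comm]
    exact mul_le_mul_of_nonneg_right (hv _) (sub_nonneg.2 hst)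
  · have chain : ∀ m n : ℤ, m ≤ n → ‖v n - v m‖ ≤ K * (n - m) := by
      intro m n hmn
      induction n, hmn using Int.leInduction with
      | base => simp
      | succ n hmn ih =>
        calc ‖v (n + 1) - v m‖ ≤ ‖v (n + 1) - v n‖ + ‖v n - v m‖ :=
              norm_sub_le_norm_sub_add_norm_sub _ _ _
          _ ≤ K + K * (n - m) := add_le_add (hv n) ih
          _ = _ := by push_cast; ring
    have e : intInterpolation v s - intInterpolation v t
        = -((1 - Int.fract s) • (v (⌊s⌋ + 1) - v ⌊s⌋) + (v ⌊t⌋ - v (⌊s⌋ + 1))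
          + Int.fract t • (v (⌊t⌋ + 1) - v ⌊t⌋)) := by
      rw [intInterpolation, intInterpolation]
      module
    have h1 : ‖(1 - Int.fract s) • (v (⌊s⌋ + 1) - v ⌊s⌋)‖ ≤ (1 - Int.fract s) * K := by
      rw [norm_smul, Real.norm_eq_abs, abs_of_nonneg (sub_nonneg.2 hs1)]
      exact mul_le_mul_of_nonneg_left (hv _) (sub_nonneg.2 hs1)
    have h2 : ‖Int.fract t • (v (⌊t⌋ + 1) - v ⌊t⌋)‖ ≤ Int.fract t * K := by
      rw [norm_smul, Real.norm_eq_abs, abs_of_nonneg ht0]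
      exact mul_le_mul_of_nonneg_left (hv _) ht0
    have h3 := chain (⌊s⌋ + 1) ⌊t⌋ h
    rw [e, norm_neg]
    refine (norm_add₃_le).trans ?_
    push_cast at h3
    have : K * (t - s) = (1 - Int.fract s) * K + K * (⌊t⌋ - (⌊s⌋ + 1)) + Int.fract t * K := by
      nth_rewrite 1 [← hs, ← ht]
      ring
    linarith

/-- A function on the circle induced by a `2π`-periodic Lipschitz function is Lipschitz. -/
theorem norm_comp_arg_sub_le {E : Type*} [SeminormedAddCommGroup E] {G : ℝ → E} {K : ℝ}
    (hK : 0 ≤ K) (hper : Function.Periodic G (2 * Real.pi))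
    (hG : ∀ s t, ‖G s - G t‖ ≤ K * |s - t|) {u w : ℂ} (hu : ‖u‖ = 1) (hw : ‖w‖ = 1) :
    ‖G u.arg - G w.arg‖ ≤ K * (Real.pi / 2 * ‖u - w‖) := by
  have hu0 : u ≠ 0 := norm_ne_zero_iff.1 (by simp [hu])
  have hw0 : w ≠ 0 := norm_ne_zero_iff.1 (by simp [hw])
  have hang : |(u / w).arg| ≤ Real.pi / 2 * ‖u - w‖ := by
    rw [← Complex.angle_eq_abs_arg hu0 hw0]
    exact Complex.angle_le_mul_norm_sub hu hw
  have hcoe : ((u.arg : ℝ) : Real.Angle) = ((w.arg + (u / w).arg : ℝ) : Real.Angle) := by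
    rw [Real.Angle.coe_add, Complex.arg_div_coe_angle hu0 hw0]
    abel
  obtain ⟨n, hn⟩ := Real.Angle.angle_eq_iff_two_pi_dvd_sub.1 hcoe
  have hGeq : G u.arg = G (w.arg + (u / w).arg) := by
    have : u.arg = w.arg + (u / w).arg + n * (2 * Real.pi) := by linarith
    rw [this]
    exact hper.int_mul n _
  rw [hGeq]
  refine (hG _ _).trans ?_
  rw [add_sub_cancel_left]
  gcongr

theorem norm_exp_mul_I_sub_le (s t : ℝ) :
    ‖Complex.exp (s * Complex.I) - Complex.exp (t * Complex.I)‖ ≤ |s - t| := by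
  have e : Complex.exp (s * Complex.I) - Complex.exp (t * Complex.I)
      = Complex.exp (t * Complex.I) * (Complex.exp (Complex.I * ((s - t : ℝ) : ℂ)) - 1) := by
    rw [mul_sub, ← Complex.exp_add, mul_one]
    congr 2
    push_cast
    ring
  rw [e, norm_mul, Complex.norm_exp_ofReal_mul_I, one_mul]
  exact Real.norm_exp_I_mul_ofReal_sub_one_le

/-- A loop all of whose values are close to a set `V` can be approximated by a closed polygon with
vertices in `V` and controlled speed. -/
theorem exists_polygonal_approximation {E : Type*} [NormedAddCommGroup E] [NormedSpace ℝ E]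
    {V : Set E} {γ : ℂ → E} {K : ℝ} (hK : 1 / 10 ≤ K)
    (hγ : ∀ u v, ‖u‖ = 1 → ‖v‖ = 1 → ‖γ u - γ v‖ ≤ K * ‖u - v‖)
    (hV : ∀ u, ‖u‖ = 1 → ∃ v ∈ V, ‖γ u - v‖ ≤ 1 / 8) :
    ∃ h : ℂ → E, (∀ u v, ‖u‖ = 1 → ‖v‖ = 1 → ‖h u - h v‖ ≤ 8 * K * ‖u - v‖) ∧
      ∀ u, ‖u‖ = 1 → ‖h u - γ u‖ ≤ 1 / 4 ∧
        ∃ v ∈ V, ∃ w ∈ V, ‖v - w‖ ≤ 1 / 2 ∧ h u ∈ segment ℝ v w := by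
  have hpi := Real.pi_gt_three
  have hpi4 := Real.pi_lt_d2
  have hK0 : 0 < K := by linarith
  set N : ℕ := ⌈16 * Real.pi * K⌉₊
  have hN1 : 16 * Real.pi * K ≤ N := Nat.le_ceil _
  have hN2 : (N : ℝ) ≤ 64 * K := by
    have := Nat.ceil_lt_add_one (show 0 ≤ 16 * Real.pi * K by positivity)
    nlinarith
  have hN0 : (0 : ℝ) < N := lt_of_lt_of_le (by positivity) hN1
  choose! rd hrdV hrd using hV
  let e : ℝ → ℂ := fun t => Complex.exp ((2 * Real.pi / N * t : ℝ) * Complex.I)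
  have he : ∀ t, ‖e t‖ = 1 := fun t => Complex.norm_exp_ofReal_mul_I _
  have hstep : ∀ s t, |s - t| ≤ 1 → ‖γ (e s) - γ (e t)‖ ≤ 1 / 8 := by
    intro s t hst
    have h1 : ‖e s - e t‖ ≤ 2 * Real.pi / N := by
      refine (norm_exp_mul_I_sub_le _ _).trans ?_
      rw [← mul_sub, abs_mul, abs_of_pos (by positivity)]
      exact mul_le_of_le_one_right (by positivity) hst
    calc ‖γ (e s) - γ (e t)‖ ≤ K * (2 * Real.pi / N) :=
          (hγ _ _ (he s) (he t)).trans (by gcongr)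
      _ ≤ 1 / 8 := by
          rw [← mul_div_assoc, div_le_iff₀ hN0]
          linarith
  let v : ℤ → E := fun n => rd (e n)
  have hvV : ∀ n, v n ∈ V := fun n => hrdV _ (he n)
  have hclose : ∀ (t : ℝ) (n : ℤ), |t - n| ≤ 1 → ‖v n - γ (e t)‖ ≤ 1 / 4 := by
    intro t n htn
    have h1 := hstep t n htn
    have h2 := hrd _ (he n)
    have := norm_sub_le_norm_sub_add_norm_sub (γ (e t)) (γ (e n)) (v n)
    rw [norm_sub_rev]
    linarith
  have hsucc : ∀ n, ‖v (n + 1) - v n‖ ≤ 3 / 8 := by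
    intro n
    have h1 := hclose ((n + 1 : ℤ) : ℝ) n (by push_cast; simp)
    have h2 := hrd _ (he (n + 1 : ℤ))
    have := norm_sub_le_norm_sub_add_norm_sub (v n) (γ (e (n + 1 : ℤ))) (v (n + 1))
    rw [norm_sub_rev]
    linarith
  have hvper : ∀ n, v (n + N) = v n := by
    intro n
    have : e ((n + N : ℤ) : ℝ) = e n := by
      have h1 : ((2 * Real.pi / N * ((n + N : ℤ) : ℝ) : ℝ) : ℂ) * Complex.I
          = ((2 * Real.pi / N * (n : ℝ) : ℝ) : ℂ) * Complex.I + 2 * Real.pi * Complex.I := by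
        have h2 : 2 * Real.pi / N * ((n + N : ℤ) : ℝ) = 2 * Real.pi / N * (n : ℝ) + 2 * Real.pi := by
          push_cast
          field_simp
        rw [h2]
        push_cast
        ring
      simp only [e]
      rw [h1, Complex.exp_add, Complex.exp_two_pi_mul_I, mul_one]
    simp only [v, this]
  have hseg : ∀ t, intInterpolation v t ∈ segment ℝ (v ⌊t⌋) (v (⌊t⌋ + 1)) := fun t =>
    ⟨1 - Int.fract t, Int.fract t, sub_nonneg.2 (Int.fract_lt_one t).le, Int.fract_nonneg t,
      sub_add_cancel _ _, rfl⟩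
  let G : ℝ → E := fun θ => intInterpolation v (N / (2 * Real.pi) * θ)
  have hGper : Function.Periodic G (2 * Real.pi) := by
    intro θ
    have : N / (2 * Real.pi) * (θ + 2 * Real.pi) = N / (2 * Real.pi) * θ + ((N : ℤ) : ℝ) := by
      push_cast
      field_simp
    simp only [G]
    rw [this, intInterpolation_add_int hvper]
  have hGlip : ∀ s t, ‖G s - G t‖ ≤ 4 * K * |s - t| := by
    intro s t
    refine (norm_intInterpolation_sub_le hsucc _ _).trans ?_
    rw [← mul_sub, abs_mul, abs_of_pos (by positivity), ← mul_assoc]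
    refine mul_le_mul_of_nonneg_right ?_ (abs_nonneg _)
    rw [← mul_div_assoc, div_le_iff₀ (by positivity)]
    nlinarith
  refine ⟨fun u => G u.arg, fun u w hu hw => ?_, fun u hu => ?_⟩
  · refine (norm_comp_arg_sub_le (by positivity) hGper hGlip hu hw).trans ?_
    rw [← mul_assoc]
    refine mul_le_mul_of_nonneg_right ?_ (norm_nonneg _)
    nlinarith
  · set t : ℝ := N / (2 * Real.pi) * u.arg with ht
    have heu : e t = u := by
      have h1 : 2 * Real.pi / N * t = u.arg := by
        rw [ht]
        field_simp
      have h2 := Complex.norm_mul_exp_arg_mul_I u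
      simp only [e]
      rw [h1]
      rwa [hu, Complex.ofReal_one, one_mul] at h2
    have hfl := Int.floor_le t
    have hfl' := Int.lt_floor_add_one t
    have h1 : ‖v ⌊t⌋ - γ u‖ ≤ 1 / 4 := by
      rw [← heu]
      exact hclose t _ (abs_le.2 ⟨by linarith, by linarith⟩)
    have h2 : ‖v (⌊t⌋ + 1) - γ u‖ ≤ 1 / 4 := by
      rw [← heu]
      refine hclose t _ (abs_le.2 ⟨?_, ?_⟩) <;> push_cast <;> linarith
    refine ⟨?_, v ⌊t⌋, hvV _, v (⌊t⌋ + 1), hvV _, ?_, hseg t⟩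
    · have := (convex_closedBall (γ u) (1 / 4)).segment_subset
        (mem_closedBall_iff_norm.2 h1) (mem_closedBall_iff_norm.2 h2) (hseg t)
      exact mem_closedBall_iff_norm.1 this
    · rw [norm_sub_rev]
      linarith [hsucc ⌊t⌋]

/-- In dimension at least three, there is a finite net `V` of the unit sphere and a point `p` such
that the cone with apex `p` over short segments with endpoints in `V` avoids a fixed ball. -/
theorem exists_net_and_apex {E : Type*} [NormedAddCommGroup E] [NormedSpace ℝ E]
    [FiniteDimensional ℝ E] (hE : 3 ≤ Module.finrank ℝ E) :
    ∃ (V : Set E) (p : E) (η : ℝ), 0 < η ∧ (∀ x : E, ‖x‖ = 1 → ∃ v ∈ V, ‖x - v‖ ≤ 1 / 8) ∧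
      ∀ v ∈ V, ∀ w ∈ V, ‖v - w‖ ≤ 1 / 2 → ∀ x ∈ segment ℝ v w, ∀ y ∈ segment ℝ p x,
        η ≤ ‖y‖ := by
  obtain ⟨V, hVs, hVf, hVc⟩ := (isCompact_sphere (0 : E) 1).finite_cover_balls
    (show (0 : ℝ) < 1 / 8 by norm_num)
  have hV1 : ∀ v ∈ V, ‖v‖ = 1 := fun v hv => mem_sphere_zero_iff_norm.1 (hVs hv)
  have hfin : (V ×ˢ V).Finite := hVf.prod hVf
  obtain ⟨p, hp⟩ : ∃ p : E, ∀ v ∈ V, ∀ w ∈ V, p ∉ Submodule.span ℝ {v, w} := by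
    let S : Finset (Submodule ℝ E) :=
      (hfin.image fun q => Submodule.span ℝ {q.1, q.2}).toFinset
    have hS : ⊤ ∉ S := by
      intro h
      simp only [S, Set.Finite.mem_toFinset, Set.mem_image] at h
      obtain ⟨⟨v, w⟩, -, h⟩ := h
      classical
      have h1 : Module.finrank ℝ (Submodule.span ℝ (({v, w} : Finset E) : Set E)) ≤ 2 :=
        (finrank_span_finset_le_card _).trans Finset.card_le_two
      rw [Finset.coe_pair] at h1
      simp only at h
      rw [h, finrank_top] at h1
      omega
    obtain ⟨p, hp⟩ := (Set.ne_univ_iff_exists_notMem _).1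
      (Subspace.biUnion_ne_univ_of_top_notMem hS)
    refine ⟨p, fun v hv w hw hmem => hp ?_⟩
    simp only [Set.mem_iUnion]
    refine ⟨Submodule.span ℝ {v, w}, ?_, hmem⟩
    simp only [S, Set.Finite.mem_toFinset]
    exact ⟨(v, w), ⟨hv, hw⟩, rfl⟩
  let T : Set E := ⋃ q ∈ {q ∈ V ×ˢ V | ‖q.1 - q.2‖ ≤ 1 / 2}, convexHull ℝ {q.1, q.2, p}
  have hT : IsClosed T := (hfin.subset (Set.sep_subset _ _)).isClosed_biUnion fun q _ =>
    (Set.toFinite _).isClosed_convexHull ℝ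
  have h0 : (0 : E) ∉ T := by
    simp only [T, Set.mem_iUnion]
    rintro ⟨⟨v, w⟩, ⟨⟨hv, hw⟩, hvw⟩, h⟩
    simp only at hv hw hvw h
    rw [convexHull_insert ⟨w, by simp⟩, convexHull_pair, mem_convexJoin] at h
    obtain ⟨a, ha, x, ⟨s, t, hs, ht, hst, rfl⟩, α, β, hα, hβ, hαβ, h⟩ := h
    rw [Set.mem_singleton_iff] at ha
    subst a
    by_cases hβt : β * t = 0
    · have hs' : α * 1 + β * s = 1 := by
        have : β * (s + t) = β := by rw [hst, mul_one]
        linarith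
      have h' : v = (β * s) • (v - w) := by
        have : α • v + (β * s) • w + (β * t) • p = 0 := by
          rw [← h]; module
        rw [hβt, zero_smul, add_zero, show α = 1 - β * s by linarith] at this
        calc v = ((1 - β * s) • v + (β * s) • w) + (β * s) • (v - w) := by module
          _ = (β * s) • (v - w) := by rw [this, zero_add]
      have h2 : ‖v‖ ≤ 1 * (1 / 2) := by
        rw [h', norm_smul, Real.norm_eq_abs, abs_of_nonneg (by positivity)]
        exact mul_le_mul (by linarith) hvw (norm_nonneg _) zero_le_one
      rw [hV1 v hv] at h2
      norm_num at h2
    · refine hp v hv w hw (Submodule.mem_span_pair.2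
        ⟨-(β * t)⁻¹ * α, -(β * t)⁻¹ * (β * s), ?_⟩)
      have : (β * t) • p = -(α • v + (β * s) • w) := by
        rw [eq_neg_iff_add_eq_zero, ← h]; module
      rw [← inv_smul_smul₀ hβt p, this]
      module
  obtain ⟨η, hη, hball⟩ := Metric.isOpen_iff.1 hT.isOpen_compl 0 h0
  refine ⟨V, p, η, hη, fun x hx => ?_, fun v hv w hw hvw x hx y hy => ?_⟩
  · have := hVc (mem_sphere_zero_iff_norm.2 hx)
    simp only [Set.mem_iUnion] at this
    obtain ⟨v, hv, hxv⟩ := this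
    exact ⟨v, hv, (mem_ball_iff_norm.1 hxv).le⟩
  · by_contra! hlt
    refine hball (mem_ball_zero_iff.2 hlt) ?_
    simp only [T, Set.mem_iUnion]
    refine ⟨(v, w), ⟨⟨hv, hw⟩, hvw⟩, ?_⟩
    have hx' : x ∈ convexHull ℝ {v, w, p} :=
      convexHull_mono (by grind) (convexHull_pair (𝕜 := ℝ) v w ▸ hx)
    exact (convex_convexHull ℝ _).segment_subset (subset_convexHull ℝ _ (by simp)) hx' hy

/-- The cone over a Lipschitz loop is Lipschitz and stays close to the loop. -/
theorem exists_cone_filling {E : Type*} [NormedAddCommGroup E] [NormedSpace ℝ E] {γ : ℂ → E}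
    {L : ℝ} (hL : 0 ≤ L) (hγ : ∀ u v, ‖u‖ = 1 → ‖v‖ = 1 → ‖γ u - γ v‖ ≤ L * ‖u - v‖)
    {u₀ : ℂ} (hu₀ : ‖u₀‖ = 1) :
    ∃ f : ℂ → E, (∀ x y, ‖f x - f y‖ ≤ 4 * L * ‖x - y‖) ∧ (∀ u, ‖u‖ = 1 → f u = γ u) ∧
      ∀ x, ‖x‖ ≤ 1 → ‖f x - γ u₀‖ ≤ 2 * L := by
  have hdiam : ∀ u, ‖u‖ = 1 → ‖γ u - γ u₀‖ ≤ 2 * L := fun u hu => by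
    have h1 := hγ u u₀ hu hu₀
    have h2 : ‖u - u₀‖ ≤ 2 := (norm_sub_le _ _).trans (by rw [hu, hu₀]; norm_num)
    nlinarith
  refine ⟨fun x => γ u₀ + ‖x‖ • (γ (x / ‖x‖) - γ u₀), fun x y => ?_, fun u hu => ?_,
    fun x hx => ?_⟩
  · rw [add_sub_add_left_eq_sub]
    refine (norm_radial_sub_le (b := id) (h := fun u => γ u - γ u₀) zero_le_one hL
      (fun s t => by simp) rfl hdiam (fun u v hu hv => by simpa using hγ u v hu hv) x y).trans_eq ?_
    ring
  · simp [hu]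
  · rw [add_sub_cancel_left, norm_smul, norm_norm]
    rcases eq_or_ne x 0 with rfl | hx0
    · simpa using hL
    · have := hdiam (x / ‖x‖) (by simp [hx0])
      nlinarith [norm_nonneg (γ (x / ‖x‖) - γ u₀), norm_nonneg x]

/-- A Lipschitz loop outside the unit ball of a normed space of dimension at least three bounds a
disk outside a smaller ball, with linear control of the Lipschitz constant. -/
theorem exists_filling_avoiding_ball (E : Type*) [NormedAddCommGroup E] [NormedSpace ℝ E]
    [FiniteDimensional ℝ E] (hE : 3 ≤ Module.finrank ℝ E) :
    ∃ D : ℝ, 4 ≤ D ∧ ∀ (L : ℝ), 0 < L → ∀ γ : ℂ → E,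
      (∀ u v, ‖u‖ = 1 → ‖v‖ = 1 → ‖γ u - γ v‖ ≤ L * ‖u - v‖) → (∀ u, ‖u‖ = 1 → 1 ≤ ‖γ u‖) →
      ∃ f : ℂ → E, (∀ x y, ‖f x - f y‖ ≤ D * L * ‖x - y‖) ∧ (∀ u, ‖u‖ = 1 → f u = γ u) ∧
        ∀ x, ‖x‖ ≤ 1 → 1 / D ≤ ‖f x‖ := by
  obtain ⟨V, p, η, hη, hnet, havoid⟩ := exists_net_and_apex hE
  have hp0 := norm_nonneg p
  have hη0 : 0 < 1 / η := by positivity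
  refine ⟨232 + 20 * ‖p‖ + 1 / η, by linarith, fun L hL γ hγ hγ1 => ?_⟩
  set D := 232 + 20 * ‖p‖ + 1 / η with hD
  have hDη : 1 / D ≤ η := by
    rw [one_div_le (by linarith) hη]
    linarith
  have hD4 : 1 / D ≤ 1 / 4 := one_div_le_one_div_of_le (by norm_num) (by linarith)
  by_cases hfar : ∃ u₀, ‖u₀‖ = 1 ∧ 10 * L ≤ ‖γ u₀‖
  · obtain ⟨u₀, hu₀, hfar⟩ := hfar
    obtain ⟨f, hf, hfγ, hfu⟩ := exists_cone_filling hL.le hγ hu₀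
    refine ⟨f, fun x y => (hf x y).trans ?_, hfγ, fun x hx => ?_⟩
    · gcongr
      linarith
    · have h1 := hfu x hx
      have h2 := hγ1 u₀ hu₀
      have h3 := norm_sub_norm_le (γ u₀) (f x)
      rw [norm_sub_rev] at h3
      linarith
  push Not at hfar
  have hL1 : 1 / 10 ≤ L := by
    have h1 := hfar 1 norm_one
    have h2 := hγ1 1 norm_one
    linarith
  let γ₁ : ℂ → E := fun u => ‖γ u‖⁻¹ • γ u
  have hγ₁ : ∀ u, ‖u‖ = 1 → ‖γ₁ u‖ = 1 := fun u hu => by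
    have := hγ1 u hu
    simp only [γ₁]
    rw [norm_smul, norm_inv, norm_norm, inv_mul_cancel₀ (by linarith)]
  have hγ₁eq : ∀ u, ‖u‖ = 1 → γ u = ‖γ u‖ • γ₁ u := fun u hu => by
    have := hγ1 u hu
    simp only [γ₁]
    rw [smul_inv_smul₀ (by linarith)]
  have hγ₁lip : ∀ u v, ‖u‖ = 1 → ‖v‖ = 1 → ‖γ₁ u - γ₁ v‖ ≤ 2 * L * ‖u - v‖ := by
    intro u v hu hv
    have hu1 := hγ1 u hu
    have e : ‖γ u‖ • (γ₁ u - γ₁ v) = (γ u - γ v) + (‖γ v‖ - ‖γ u‖) • γ₁ v := by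
      nth_rewrite 2 [hγ₁eq u hu]
      nth_rewrite 1 [hγ₁eq v hv]
      module
    calc ‖γ₁ u - γ₁ v‖ ≤ ‖γ u‖ * ‖γ₁ u - γ₁ v‖ := le_mul_of_one_le_left (norm_nonneg _) hu1
      _ = ‖(γ u - γ v) + (‖γ v‖ - ‖γ u‖) • γ₁ v‖ := by
          rw [← e, norm_smul, norm_norm]
      _ ≤ ‖γ u - γ v‖ + |‖γ v‖ - ‖γ u‖| := by
          refine (norm_add_le _ _).trans ?_
          rw [norm_smul, hγ₁ v hv, mul_one, Real.norm_eq_abs]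
      _ ≤ 2 * ‖γ u - γ v‖ := by
          have := abs_norm_sub_norm_le (γ v) (γ u)
          rw [norm_sub_rev] at this
          linarith
      _ ≤ _ := by linarith [hγ u v hu hv]
  obtain ⟨h, hlip, hh⟩ := exists_polygonal_approximation (K := 2 * L) (by linarith) hγ₁lip
    fun u hu => hnet _ (hγ₁ u hu)
  have hh2 : ∀ u, ‖u‖ = 1 → ‖h u‖ ≤ 2 := fun u hu => by
    have h1 := (hh u hu).1
    have h2 := norm_sub_norm_le (h u) (γ₁ u)
    linarith [hγ₁ u hu]
  let a : ℝ → ℝ := fun s => min (2 * s) 1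
  let b : ℝ → ℝ := fun s => max (2 * s - 1) 0
  have ha : ∀ s t, |a s - a t| ≤ 2 * |s - t| := fun s t => by
    refine (abs_min_sub_min_le_max _ _ _ _).trans ?_
    rw [← mul_sub, abs_mul]
    simp
  have hb : ∀ s t, |b s - b t| ≤ 2 * |s - t| := fun s t => by
    refine (abs_max_sub_max_le_abs _ _ _).trans ?_
    rw [sub_sub_sub_cancel_right, ← mul_sub, abs_mul]
    simp
  refine ⟨fun x => p + a ‖x‖ • (h (x / ‖x‖) - p) + b ‖x‖ • (γ (x / ‖x‖) - h (x / ‖x‖)),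
    fun x y => ?_, fun u hu => ?_, fun x hx => ?_⟩
  · have h1 := norm_radial_sub_le (b := a) (h := fun u => h u - p) (M := 2 + ‖p‖)
      (K := 8 * (2 * L)) zero_le_two (by positivity) ha (by simp [a])
      (fun u hu => (norm_sub_le _ _).trans (by linarith [hh2 u hu]))
      (fun u v hu hv => by simpa using hlip u v hu hv) x y
    have h2 := norm_radial_sub_le (b := b) (h := fun u => γ u - h u) (M := 10 * L + 2)
      (K := L + 8 * (2 * L)) zero_le_two (by positivity) hb (by simp [b])
      (fun u hu => (norm_sub_le _ _).trans (by linarith [hh2 u hu, hfar u hu]))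
      (fun u v hu hv => by
        rw [sub_sub_sub_comm, add_mul]
        exact (norm_sub_le _ _).trans (add_le_add (hγ u v hu hv) (hlip u v hu hv))) x y
    rw [add_sub_add_comm, add_sub_add_left_eq_sub]
    refine (norm_add_le _ _).trans ((add_le_add h1 h2).trans ?_)
    rw [← add_mul]
    refine mul_le_mul_of_nonneg_right ?_ (norm_nonneg _)
    have h3 : ‖p‖ ≤ 10 * L * ‖p‖ := le_mul_of_one_le_left hp0 (by linarith)
    have h4 : 0 < 1 / η * L := by positivity
    rw [hD]
    linarith
  · simp only [hu, a, b]
    norm_num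
  · rcases le_total ‖x‖ (1 / 2) with hx2 | hx2
    · have h1 : a ‖x‖ = 2 * ‖x‖ := min_eq_left (by linarith)
      have h2 : b ‖x‖ = 0 := max_eq_right (by linarith)
      simp only [h1, h2, zero_smul, add_zero]
      have key : ∀ u, ‖u‖ = 1 → η ≤ ‖p + (2 * ‖x‖) • (h u - p)‖ := fun u hu => by
        obtain ⟨-, v, hv, w, hw, hvw, hseg⟩ := hh u hu
        refine havoid v hv w hw hvw _ hseg _
          ⟨1 - 2 * ‖x‖, 2 * ‖x‖, by linarith, by positivity, by ring, ?_⟩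
        module
      rcases eq_or_ne x 0 with rfl | hx0
      · simpa using hDη.trans (key 1 norm_one)
      · exact hDη.trans (key _ (by simp [hx0]))
    · have h1 : a ‖x‖ = 1 := min_eq_right (by linarith)
      have h2 : b ‖x‖ = 2 * ‖x‖ - 1 := max_eq_left (by linarith)
      have hx0 : x ≠ 0 := by
        rintro rfl
        norm_num at hx2
      simp only [h1, h2, one_smul, add_sub_cancel]
      set u := x / (‖x‖ : ℂ)
      have hu : ‖u‖ = 1 := by simp [u, hx0]
      set s := 2 * ‖x‖ - 1
      have hs0 : 0 ≤ s := by simp only [s]; linarith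
      have hs1 : s ≤ 1 := by simp only [s]; linarith
      have e : h u + s • (γ u - h u) = (1 - s + s * ‖γ u‖) • γ₁ u + (1 - s) • (h u - γ₁ u) := by
        nth_rewrite 1 [hγ₁eq u hu]
        module
      have h3 : ‖(1 - s + s * ‖γ u‖) • γ₁ u‖ = 1 - s + s * ‖γ u‖ := by
        rw [norm_smul, hγ₁ u hu, mul_one, Real.norm_eq_abs, abs_of_nonneg]
        have : 0 ≤ 1 - s := by linarith
        positivity
      have h4 : ‖(1 - s) • (h u - γ₁ u)‖ ≤ 1 * (1 / 4) := by
        rw [norm_smul, Real.norm_eq_abs, abs_of_nonneg (by linarith)]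
        exact mul_le_mul (by linarith) (hh u hu).1 (norm_nonneg _) zero_le_one
      have h5 := norm_sub_le_norm_add ((1 - s + s * ‖γ u‖) • γ₁ u) ((1 - s) • (h u - γ₁ u))
      have h6 := hγ1 u hu
      rw [e]
      nlinarith


/-- Avoidance in cosets, part (2), abstract quantitative form: for every `C ≥ 1` and
`k ≥ 3` there is `D > 0` such that for any metric space `X` with basepoint `x₀` and any
undistorted quasi-isometric embedding `φ : ℝ^k → X` whose image has a closest point to
`x₀`, every `L`-Lipschitz loop in the flat that is `r`-avoidant under `φ` (with `r ≥ D`)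
extends to a `(D·L)`-Lipschitz map of the unit disk into the flat that is
`r/D`-avoidant under `φ`. -/
theorem stmt_5 (C : ℝ) (hC : 1 ≤ C) (k : ℕ) (hk : 3 ≤ k) :
    ∃ D : ℝ, 0 < D ∧
      ∀ (X : Type) [MetricSpace X] (x₀ : X)
        (φ : EuclideanSpace ℝ (Fin k) → X),
        (∀ a b, dist (φ a) (φ b) ≤ ‖a - b‖ ∧ ‖a - b‖ ≤ C * dist (φ a) (φ b) + C) →
        (∃ b₀, ∀ a, dist x₀ (φ b₀) ≤ dist x₀ (φ a)) →
        ∀ (r : ℝ), D ≤ r → ∀ (L : ℝ), 0 < L →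
          ∀ γ : Metric.sphere (0 : ℂ) 1 → EuclideanSpace ℝ (Fin k),
            LipschitzWith (Real.toNNReal L) γ →
            (∀ z, r ≤ dist x₀ (φ (γ z))) →
            ∃ f : Metric.closedBall (0 : ℂ) 1 → EuclideanSpace ℝ (Fin k),
              LipschitzWith (Real.toNNReal (D * L)) f ∧
              (∀ z : Metric.sphere (0 : ℂ) 1,
                f ⟨z.1, Metric.sphere_subset_closedBall z.2⟩ = γ z) ∧
              (∀ x, r / D ≤ dist x₀ (φ (f x))) := by
  classical
  have hfr : 3 ≤ Module.finrank ℝ (EuclideanSpace ℝ (Fin k)) := by simpa using hk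
  obtain ⟨D₀, hD₀, hfill⟩ := exists_filling_avoiding_ball _ hfr
  have hC0 : 0 < C := by linarith
  have hDC : D₀ ≤ D₀ * C := le_mul_of_one_le_right (by linarith) hC
  refine ⟨8 * (D₀ * C), by positivity, ?_⟩
  intro X _ x₀ φ hφ ⟨b₀, hb₀⟩ r hr L hL γ hγ hγr
  set D := 8 * (D₀ * C) with hD
  have hr0 : 0 < r := by linarith
  have hDL : D₀ * L ≤ D * L := by
    gcongr
    linarith
  let Γ : ℂ → EuclideanSpace ℝ (Fin k) := fun z =>
    if hz : z ∈ Metric.sphere (0 : ℂ) 1 then γ ⟨z, hz⟩ else 0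
  have hmem : ∀ u : ℂ, ‖u‖ = 1 → u ∈ Metric.sphere (0 : ℂ) 1 := fun u hu => by simpa using hu
  have hΓγ : ∀ u (hu : ‖u‖ = 1), Γ u = γ ⟨u, hmem u hu⟩ := fun u hu => dif_pos (hmem u hu)
  have hΓ : ∀ u v, ‖u‖ = 1 → ‖v‖ = 1 → ‖Γ u - Γ v‖ ≤ L * ‖u - v‖ := fun u v hu hv => by
    rw [hΓγ u hu, hΓγ v hv, ← dist_eq_norm, ← dist_eq_norm]
    have := hγ.dist_le_mul ⟨u, hmem u hu⟩ ⟨v, hmem v hv⟩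
    rwa [Real.coe_toNNReal _ hL.le] at this
  suffices H : ∃ f : ℂ → EuclideanSpace ℝ (Fin k), (∀ x y, ‖f x - f y‖ ≤ D₀ * L * ‖x - y‖) ∧
      (∀ u, ‖u‖ = 1 → f u = Γ u) ∧ ∀ x, ‖x‖ ≤ 1 → r / D ≤ dist x₀ (φ (f x)) by
    obtain ⟨f, hf, hfΓ, hfr⟩ := H
    refine ⟨fun x => f x, LipschitzWith.of_dist_le_mul fun x y => ?_, fun z => ?_, fun x => ?_⟩
    · rw [Real.coe_toNNReal _ (by positivity), dist_eq_norm, Subtype.dist_eq, dist_eq_norm]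
      exact (hf x y).trans (by gcongr)
    · have hz : ‖z.1‖ = 1 := mem_sphere_zero_iff_norm.1 z.2
      exact (hfΓ _ hz).trans (hΓγ _ hz)
    · exact hfr _ (mem_closedBall_zero_iff.1 x.2)
  rcases le_or_gt (r / 2) (dist x₀ (φ b₀)) with hm | hm
  · obtain ⟨f, hf, hfΓ, -⟩ := exists_cone_filling hL.le hΓ norm_one
    refine ⟨f, fun x y => (hf x y).trans (by gcongr), hfΓ, fun x _ => ?_⟩
    refine le_trans ?_ (hm.trans (hb₀ _))
    gcongr
    linarith
  · set R := r / 2 with hR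
    have hR0 : 0 < R := by positivity
    have hfar : ∀ u, ‖u‖ = 1 → R ≤ ‖Γ u - b₀‖ := fun u hu => by
      have h1 := hγr ⟨u, hmem u hu⟩
      rw [← hΓγ u hu] at h1
      have h2 := dist_triangle x₀ (φ b₀) (φ (Γ u))
      have h3 := (hφ b₀ (Γ u)).1
      rw [norm_sub_rev] at h3
      linarith
    obtain ⟨f, hf, hfΓ, hfb⟩ := hfill (R⁻¹ * L) (by positivity) (fun u => R⁻¹ • (Γ u - b₀))
      (fun u v hu hv => by
        rw [← smul_sub, sub_sub_sub_cancel_right, norm_smul, norm_inv, Real.norm_eq_abs,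
          abs_of_pos hR0, mul_assoc]
        exact mul_le_mul_of_nonneg_left (hΓ u v hu hv) (by positivity))
      (fun u hu => by
        rw [norm_smul, norm_inv, Real.norm_eq_abs, abs_of_pos hR0, inv_mul_eq_div,
          one_le_div hR0]
        exact hfar u hu)
    refine ⟨fun x => b₀ + R • f x, fun x y => ?_, fun u hu => ?_, fun x hx => ?_⟩
    · rw [add_sub_add_left_eq_sub, ← smul_sub, norm_smul, Real.norm_eq_abs, abs_of_pos hR0]
      calc R * ‖f x - f y‖ ≤ R * (D₀ * (R⁻¹ * L) * ‖x - y‖) := by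
            gcongr
            exact hf x y
        _ = D₀ * L * ‖x - y‖ := by field_simp
    · simp only [hfΓ u hu]
      rw [smul_inv_smul₀ hR0.ne', add_sub_cancel]
    · have h1 := (hφ (b₀ + R • f x) b₀).2
      rw [add_sub_cancel_left, norm_smul, Real.norm_eq_abs, abs_of_pos hR0] at h1
      have h2 := dist_triangle_left (φ (b₀ + R • f x)) (φ b₀) x₀
      have h3 := hb₀ (b₀ + R • f x)
      set d := dist x₀ (φ (b₀ + R • f x))
      have h4 : R * (1 / D₀) ≤ C * (2 * d) + C :=
        (mul_le_mul_of_nonneg_left (hfb x hx) hR0.le).trans (h1.trans (by gcongr; linarith))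
      have h5 : R * (1 / D₀) = 4 * C * (r / D) := by
        rw [hR, hD]
        field_simp
        norm_num
      have h6 : 1 ≤ r / D := (one_le_div (by positivity)).2 hr
      rw [h5] at h4
      have h7 : C * (4 * (r / D)) ≤ C * (2 * d + 1) := by linarith
      have h8 := le_of_mul_le_mul_left h7 hC0
      linarith
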